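/- Let A be a finitely generated abelian group with an endomorphism φ, and q a prime. Suppose A has a finite filtration 0 = F_0 ⊆ F_1 ⊆ ··· ⊆ F_m = A by φ-invariant subgroups such that φ acts on each quotient F_i/F_{i-1} ⊗ ℤ/q by multiplication by λ_i ∈ (ℤ/qℤ)*, with λ_1, ..., λ_m pairwise distinct. Then the q-torsion subgroup of A is isomorphic to the direct sum of the q-torsion subgroups of the quotients F_i/F_{i-1}. -/

import Mathlib

open DirectSum

/-- The `q`-primary torsion subgroup of an abelian group: elements killed by a power of `q`. -/
def qPrimaryTorsion (q : ℕ) (A : Type*) [AddCommGroup A] : AddSubgroup A where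
  carrier := {a | ∃ k : ℕ, q ^ k • a = 0}
  zero_mem' := ⟨0, smul_zero _⟩
  add_mem' := by
    rintro a b ⟨k, hk⟩ ⟨l, hl⟩
    have ha : q ^ (k + l) • a = 0 := by rw [pow_add, mul_comm, mul_smul, hk, smul_zero]
    have hb : q ^ (k + l) • b = 0 := by rw [pow_add, mul_smul, hl, smul_zero]
    exact ⟨k + l, by rw [smul_add, ha, hb, add_zero]⟩
  neg_mem' := by rintro a ⟨k, hk⟩; exact ⟨k, by rw [smul_neg, hk, neg_zero]⟩

open Polynomial

section Torsion

variable {q : ℕ} {A B : Type*} [AddCommGroup A] [AddCommGroup B]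

theorem mem_qPrimaryTorsion {a : A} : a ∈ qPrimaryTorsion q A ↔ ∃ k : ℕ, q ^ k • a = 0 :=
  Iff.rfl

theorem map_mem_qPrimaryTorsion (f : A →+ B) {a : A} (ha : a ∈ qPrimaryTorsion q A) :
    f a ∈ qPrimaryTorsion q B := by
  obtain ⟨k, hk⟩ := ha
  exact ⟨k, by rw [← map_nsmul, hk, map_zero]⟩

theorem mem_qPrimaryTorsion_of_pow_smul {a : A} (n : ℕ)
    (ha : q ^ n • a ∈ qPrimaryTorsion q A) : a ∈ qPrimaryTorsion q A := by
  obtain ⟨k, hk⟩ := ha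
  exact ⟨k + n, by rw [pow_add, mul_smul, hk]⟩

/-- The isomorphism of `q`-primary torsion subgroups induced by an isomorphism. -/
noncomputable def qPrimaryTorsionCongr (q : ℕ) (e : A ≃+ B) :
    qPrimaryTorsion q A ≃+ qPrimaryTorsion q B where
  toFun a := ⟨e a, map_mem_qPrimaryTorsion e.toAddMonoidHom a.2⟩
  invFun b := ⟨e.symm b, map_mem_qPrimaryTorsion e.symm.toAddMonoidHom b.2⟩
  left_inv a := by simp
  right_inv b := by simp
  map_add' a b := by ext; simp

theorem exists_pow_smul_eq_zero_of_fg (q : ℕ) (hA : AddGroup.FG A) :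
    ∃ N : ℕ, ∀ a ∈ qPrimaryTorsion q A, ∀ n ≥ N, q ^ n • a = 0 := by
  have : Module.Finite ℤ A := Module.Finite.iff_addGroup_fg.mpr hA
  have hmono : Monotone fun n : ℕ =>
      LinearMap.ker (((q ^ n : ℕ) : ℤ) • (LinearMap.id : A →ₗ[ℤ] A)) := by
    intro m n hmn a ha
    obtain ⟨d, rfl⟩ := Nat.exists_eq_add_of_le' hmn
    simp only [LinearMap.mem_ker, LinearMap.smul_apply, LinearMap.id_apply, natCast_zsmul] at ha ⊢
    rw [pow_add, mul_smul, ha, smul_zero]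
  obtain ⟨N, hN⟩ := monotone_stabilizes_iff_noetherian.mpr
    (inferInstance : IsNoetherian ℤ A) ⟨_, hmono⟩
  refine ⟨N, fun a ⟨k, hk⟩ n hn => ?_⟩
  have hker : a ∈ LinearMap.ker (((q ^ (N + k) : ℕ) : ℤ) • (LinearMap.id : A →ₗ[ℤ] A)) := by
    simp only [LinearMap.mem_ker, LinearMap.smul_apply, LinearMap.id_apply, natCast_zsmul]
    rw [pow_add, mul_smul, hk, smul_zero]
  have h := hmono hn ((hN (N + k) (Nat.le_add_right N k)).ge hker)
  simpa only [LinearMap.mem_ker, LinearMap.smul_apply, LinearMap.id_apply, natCast_zsmul] using h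

end Torsion

theorem aeval_apply_mem_of_forall {A : Type*} [AddCommGroup A] (φ : Module.End ℤ A)
    (G : AddSubgroup A) (P : ℤ[X]) (hG : ∀ x ∈ G, φ x ∈ G) {x : A} (hx : x ∈ G) :
    aeval φ P x ∈ G := by
  induction P using Polynomial.induction_on' with
  | add P R hP hR =>
    rw [map_add]
    exact add_mem hP hR
  | monomial n c =>
    have hpow : ∀ n : ℕ, (φ ^ n) x ∈ G := by
      intro n
      induction n with
      | zero => exact hx
      | succ n ih =>
        rw [pow_succ']
        exact hG _ ih
    rw [← C_mul_X_pow_eq_monomial]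
    simpa using zsmul_mem (hpow n) c

section Splitting

variable {q : ℕ} {A : Type*} [AddCommGroup A] (B : AddSubgroup A)

/-- An endomorphism that vanishes on `B` and is the identity on `A ⧸ B`, both modulo `q ^ N`,
splits the `q`-primary torsion when `q ^ N` annihilates the torsion of `A` and of `A ⧸ B`. -/
theorem nonempty_qPrimaryTorsion_addEquiv_prod {N : ℕ}
    (hA : ∀ a ∈ qPrimaryTorsion q A, q ^ N • a = 0)
    (hC : ∀ c ∈ qPrimaryTorsion q (A ⧸ B), q ^ N • c = 0) (E : A →+ A)
    (hEB : ∀ b ∈ B, ∃ b' ∈ B, E b = q ^ N • b')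
    (hEC : ∀ a, ∃ y ∈ B, ∃ z, a - E a = y + q ^ N • z) :
    Nonempty (qPrimaryTorsion q A ≃+ qPrimaryTorsion q B × qPrimaryTorsion q (A ⧸ B)) := by
  have hE0 : ∀ b ∈ B, b ∈ qPrimaryTorsion q A → E b = 0 := by
    intro b hb hbt
    obtain ⟨b', -, h⟩ := hEB b hb
    rw [h]
    exact hA _ (mem_qPrimaryTorsion_of_pow_smul N (h ▸ map_mem_qPrimaryTorsion E hbt))
  have hEB' : ∀ a : A, (a : A ⧸ B) ∈ qPrimaryTorsion q (A ⧸ B) →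
      (E a : A ⧸ B) ∈ qPrimaryTorsion q (A ⧸ B) → a - E a ∈ B := by
    intro a ha hEa
    obtain ⟨y, hy, z, h⟩ := hEC a
    have h1 : ((a - E a : A) : A ⧸ B) = q ^ N • (z : A ⧸ B) := by
      rw [h, QuotientAddGroup.mk_add, (QuotientAddGroup.eq_zero_iff y).mpr hy, zero_add,
        QuotientAddGroup.mk_nsmul]
    rw [← QuotientAddGroup.eq_zero_iff, h1]
    refine hC _ (mem_qPrimaryTorsion_of_pow_smul N (h1 ▸ ?_))
    rw [QuotientAddGroup.mk_sub]
    exact sub_mem ha hEa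
  have hmk : ∀ a ∈ qPrimaryTorsion q A, (a : A ⧸ B) ∈ qPrimaryTorsion q (A ⧸ B) :=
    fun a ha => map_mem_qPrimaryTorsion (QuotientAddGroup.mk' B) ha
  have hρ : ∀ a ∈ qPrimaryTorsion q A, a - E a ∈ B := fun a ha =>
    hEB' a (hmk a ha) (hmk _ (map_mem_qPrimaryTorsion E ha))
  have hBt : ∀ b : B, b ∈ qPrimaryTorsion q B ↔ (b : A) ∈ qPrimaryTorsion q A := by
    intro b
    simp only [mem_qPrimaryTorsion, ← AddSubgroup.coe_nsmul, ZeroMemClass.coe_eq_zero]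
  let f : qPrimaryTorsion q A →+ qPrimaryTorsion q B × qPrimaryTorsion q (A ⧸ B) :=
    { toFun := fun a =>
        (⟨⟨a - E a, hρ a a.2⟩,
          (hBt _).mpr (sub_mem a.2 (map_mem_qPrimaryTorsion E a.2))⟩, ⟨(a : A), hmk a a.2⟩)
      map_zero' := by ext <;> simp
      map_add' := fun a b => by
        ext
        · simp only [AddSubgroup.coe_add, map_add, Prod.mk_add_mk]
          abel
        · simp }
  refine ⟨AddEquiv.ofBijective f ⟨?_, ?_⟩⟩
  · rw [injective_iff_map_eq_zero]
    rintro ⟨a, ha⟩ h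
    obtain ⟨h1, h2⟩ := Prod.ext_iff.mp h
    have h1' : a - E a = 0 := congrArg (fun x : qPrimaryTorsion q B => (x : A)) h1
    have h2' : (a : A ⧸ B) = 0 := congrArg Subtype.val h2
    rw [hE0 a ((QuotientAddGroup.eq_zero_iff a).mp h2') ha, sub_zero] at h1'
    exact Subtype.ext h1'
  · rintro ⟨⟨b, hb⟩, ⟨x, hx⟩⟩
    obtain ⟨a, rfl⟩ := QuotientAddGroup.mk_surjective x
    have haB : q ^ N • a ∈ B := by
      rw [← QuotientAddGroup.eq_zero_iff, QuotientAddGroup.mk_nsmul]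
      exact hC _ hx
    obtain ⟨b', hb', h⟩ := hEB _ haB
    have ht : E a - b' ∈ qPrimaryTorsion q A :=
      ⟨N, by rw [smul_sub, ← map_nsmul, h, sub_self]⟩
    have hmkE : ((E a - b' : A) : A ⧸ B) = E a := by
      rw [QuotientAddGroup.mk_sub, (QuotientAddGroup.eq_zero_iff b').mpr hb', sub_zero]
    have hEa : (a : A ⧸ B) = E a := by
      rw [← sub_eq_zero, ← QuotientAddGroup.mk_sub, QuotientAddGroup.eq_zero_iff]
      exact hEB' a hx (hmkE ▸ hmk _ ht)
    have hb0 : E (b : A) = 0 := hE0 _ b.2 ((hBt b).mp hb)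
    have hr0 : E (E a - b' - E (E a - b')) = 0 :=
      hE0 _ (hρ _ ht) (sub_mem ht (map_mem_qPrimaryTorsion E ht))
    have hsum : (E a - b') + (b - (E a - b' - E (E a - b'))) = b + E (E a - b') := by abel
    refine ⟨⟨b + E (E a - b'), add_mem ((hBt b).mp hb) (map_mem_qPrimaryTorsion E ht)⟩, ?_⟩
    refine Prod.ext (Subtype.ext (Subtype.ext ?_)) (Subtype.ext ?_)
    · change (b : A) + E (E a - b') - E (b + E (E a - b')) = b
      rw [map_sub, sub_eq_zero] at hr0
      rw [map_add, hb0, ← hr0, zero_add, add_sub_cancel_right]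
    · change ((b + E (E a - b') : A) : A ⧸ B) = a
      rw [← hsum, QuotientAddGroup.mk_add, hmkE, ← hEa]
      refine add_eq_left.mpr ((QuotientAddGroup.eq_zero_iff _).mpr ?_)
      exact sub_mem b.2 (hρ _ ht)

/-- An endomorphism that vanishes on `B` and is the identity on `A ⧸ B`, both modulo `q`,
can be improved to one with the same properties modulo `q ^ N`. -/
theorem exists_endomorphism_mod_pow (Ψ : Module.End ℤ A)
    (hΨB : ∀ b ∈ B, ∃ b' ∈ B, Ψ b = q • b')
    (hΨC : ∀ a, ∃ y ∈ B, ∃ z, a - Ψ a = y + q • z) (N : ℕ) :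
    ∃ E : A →+ A, (∀ b ∈ B, ∃ b' ∈ B, E b = q ^ N • b') ∧
      ∀ a, ∃ y ∈ B, ∃ z, a - E a = y + q ^ N • z := by
  have hΨ : ∀ b ∈ B, Ψ b ∈ B := fun b hb => by
    obtain ⟨b', hb', h⟩ := hΨB b hb
    exact h ▸ nsmul_mem hb' q
  have haeval : ∀ p : ℤ[X], ∀ b ∈ B, aeval Ψ p b ∈ B := fun p b hb =>
    aeval_apply_mem_of_forall Ψ B p hΨ hb
  have hpow : ∀ n : ℕ, ∀ b ∈ B, ∃ b' ∈ B, (Ψ ^ n) b = q ^ n • b' := by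
    intro n
    induction n with
    | zero => exact fun b hb => ⟨b, hb, by simp⟩
    | succ n ih =>
      intro b hb
      obtain ⟨b', hb', h⟩ := ih b hb
      obtain ⟨b'', hb'', h'⟩ := hΨB b' hb'
      exact ⟨b'', hb'', by
        rw [pow_succ', Module.End.mul_apply, h, map_nsmul, h', pow_succ, mul_smul]⟩
  have hpow' : ∀ n : ℕ, ∀ a, ∃ y ∈ B, ∃ z, ((1 - Ψ) ^ n) a = y + q ^ n • z := by
    intro n
    induction n with
    | zero => exact fun a => ⟨0, zero_mem B, a, by simp⟩
    | succ n ih =>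
      intro a
      obtain ⟨y, hy, z, h⟩ := ih a
      obtain ⟨y', hy', z', h'⟩ := hΨC z
      refine ⟨y - Ψ y + q ^ n • y', add_mem (sub_mem hy (hΨ y hy)) (nsmul_mem hy' _), z', ?_⟩
      have h1 : (1 - Ψ) z = z - Ψ z := rfl
      rw [pow_succ', Module.End.mul_apply, h, map_add, map_nsmul, h1, h', pow_succ, mul_smul,
        smul_add, add_assoc]
      rfl
  have hcop : IsCoprime ((X : ℤ[X]) ^ N) ((1 - X) ^ N) :=
    IsCoprime.pow ⟨1, 1, by ring⟩
  obtain ⟨f, g, hfg⟩ := hcop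
  refine ⟨(aeval Ψ (f * X ^ N)).toAddMonoidHom, fun b hb => ?_, fun a => ?_⟩
  · obtain ⟨b', hb', h⟩ := hpow N b hb
    refine ⟨aeval Ψ f b', haeval f b' hb', ?_⟩
    simp [h]
  · obtain ⟨y, hy, z, h⟩ := hpow' N a
    refine ⟨aeval Ψ g y, haeval g y hy, aeval Ψ g z, ?_⟩
    have h1 : a - aeval Ψ (f * X ^ N) a = aeval Ψ (g * (1 - X) ^ N) a := by
      rw [← eq_sub_iff_add_eq'] at hfg
      rw [hfg]
      simp
    refine h1.trans ?_
    simp [h]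

/-- If an endomorphism vanishes modulo `q` on `B` and acts modulo `q` on `A ⧸ B` as an integer
prime to `q`, then the `q`-primary torsion of `A` splits along `B`. -/
theorem nonempty_qPrimaryTorsion_addEquiv_prod_of_isCoprime (hA : AddGroup.FG A)
    (Ψ : Module.End ℤ A) {u : ℤ} (hu : IsCoprime u q)
    (hΨB : ∀ b ∈ B, ∃ b' ∈ B, Ψ b = q • b')
    (hΨC : ∀ a, ∃ y ∈ B, ∃ z, Ψ a - u • a = y + q • z) :
    Nonempty (qPrimaryTorsion q A ≃+ qPrimaryTorsion q B × qPrimaryTorsion q (A ⧸ B)) := by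
  obtain ⟨v, s, hvs⟩ := hu
  obtain ⟨N₁, hN₁⟩ := exists_pow_smul_eq_zero_of_fg q hA
  obtain ⟨N₂, hN₂⟩ := exists_pow_smul_eq_zero_of_fg (A := A ⧸ B) q inferInstance
  obtain ⟨E, hEB, hEC⟩ := exists_endomorphism_mod_pow (q := q) B (v • Ψ) (fun b hb => by
      obtain ⟨b', hb', h⟩ := hΨB b hb
      exact ⟨v • b', zsmul_mem hb' v, by rw [LinearMap.smul_apply, h, smul_comm]⟩)
    (fun a => by
      obtain ⟨y, hy, z, h⟩ := hΨC a
      refine ⟨-(v • y), neg_mem (zsmul_mem hy v), s • a - v • z, ?_⟩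
      have h1 : a = v • u • a + s • q • a := by
        rw [← natCast_zsmul a q, ← mul_smul, ← mul_smul, ← add_smul, hvs, one_smul]
      rw [LinearMap.smul_apply, eq_add_of_sub_eq h]
      nth_rewrite 1 [h1]
      simp only [smul_add, smul_sub, smul_comm q]
      abel) (max N₁ N₂)
  exact nonempty_qPrimaryTorsion_addEquiv_prod B (fun a ha => hN₁ a ha _ (le_max_left _ _))
    (fun c hc => hN₂ c hc _ (le_max_right _ _)) E hEB hEC

end Splitting

theorem nonempty_addEquiv_pi_of_forall_addEquiv_prod {m : ℕ} (G : Fin (m + 1) → Type*)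
    [∀ i, AddCommGroup (G i)] (Q : Fin m → Type*) [∀ i, AddCommGroup (Q i)]
    (h0 : Subsingleton (G 0))
    (h : ∀ i : Fin m, Nonempty (G i.succ ≃+ G i.castSucc × Q i)) :
    Nonempty (G (Fin.last m) ≃+ ∀ i, Q i) := by
  induction m with
  | zero =>
    have : Unique (G (Fin.last 0)) := @Unique.mk' _ ⟨0⟩ h0
    exact ⟨AddEquiv.ofUnique⟩
  | succ m ih =>
    obtain ⟨e⟩ := ih (fun i => G i.castSucc) (fun i => Q i.castSucc) h0 (fun i => h i.castSucc)
    obtain ⟨e'⟩ := h (Fin.last m)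
    let s : (Q (Fin.last m) × ∀ i : Fin m, Q i.castSucc) ≃+ ∀ i, Q i :=
      { Fin.snocEquiv Q with
        map_add' := fun x y => by
          funext i
          refine Fin.lastCases ?_ (fun i => ?_) i <;> simp [Fin.snocEquiv] }
    exact ⟨(e'.trans (e.prodCongr (AddEquiv.refl _))).trans (AddEquiv.prodComm.trans s)⟩

section Filtration

variable {q m : ℕ} {A : Type*} [AddCommGroup A] {φ : Module.End ℤ A}
  {F : Fin (m + 1) → AddSubgroup A} {lam : Fin m → ℤ}

theorem exists_aeval_prod_eq_smul (hmono : Monotone F) (hbot : F 0 = ⊥)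
    (hinv : ∀ i, ∀ x ∈ F i, φ x ∈ F i)
    (heig : ∀ i : Fin m, ∀ x ∈ F i.succ, ∃ y ∈ F i.castSucc, ∃ z ∈ F i.succ,
      φ x - lam i • x = y + q • z) (i : Fin (m + 1)) :
    ∀ b ∈ F i, ∃ b' ∈ F i,
      aeval φ (∏ j : Fin m with j.castSucc < i, (X - C (lam j))) b = q • b' := by
  induction i using Fin.induction with
  | zero =>
    intro b hb
    rw [hbot, AddSubgroup.mem_bot] at hb
    exact ⟨0, zero_mem _, by simp [hb]⟩
  | succ i ih =>
    intro b hb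
    obtain ⟨y, hy, z, hz, h⟩ := heig i b hb
    obtain ⟨y', hy', h'⟩ := ih y hy
    have hset : (Finset.univ.filter fun j : Fin m => j.castSucc < i.succ) =
        insert i (Finset.univ.filter fun j : Fin m => j.castSucc < i.castSucc) := by
      ext j
      simp only [Finset.mem_filter_univ, Finset.mem_insert, Fin.lt_def, Fin.ext_iff,
        Fin.val_castSucc, Fin.val_succ]
      omega
    rw [hset, Finset.prod_insert (by simp), mul_comm]
    set P : ℤ[X] := ∏ j : Fin m with j.castSucc < i.castSucc, (X - C (lam j))
    refine ⟨y' + aeval φ P z, add_mem (hmono i.castSucc_le_succ hy')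
      (aeval_apply_mem_of_forall φ (F i.succ) P (hinv i.succ) hz), ?_⟩
    have h1 : aeval φ (X - C (lam i)) b = y + q • z := by
      rw [← h]
      simp
    rw [map_mul, Module.End.mul_apply, h1, map_add, h', map_nsmul, smul_add]

theorem exists_aeval_sub_eval_smul {G H : AddSubgroup A} (hG : ∀ x ∈ G, φ x ∈ G)
    (hH : ∀ x ∈ H, φ x ∈ H) {l : ℤ}
    (heig : ∀ x ∈ H, ∃ y ∈ G, ∃ z ∈ H, φ x - l • x = y + q • z) (P : ℤ[X]) :
    ∀ x ∈ H, ∃ y ∈ G, ∃ z ∈ H, aeval φ P x - P.eval l • x = y + q • z := by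
  intro x hx
  obtain ⟨y, hy, z, hz, h⟩ := heig x hx
  obtain ⟨R, hR⟩ := X_sub_C_dvd_sub_C_eval (a := l) (p := P)
  refine ⟨aeval φ R y, aeval_apply_mem_of_forall φ G R hG hy, aeval φ R z,
    aeval_apply_mem_of_forall φ H R hH hz, ?_⟩
  have h1 : aeval φ (X - C l) x = y + q • z := by
    rw [← h]
    simp
  have h2 : aeval φ P x - P.eval l • x = aeval φ (P - C (P.eval l)) x := by simp
  rw [h2, hR, mul_comm, map_mul, Module.End.mul_apply, h1, map_add, map_nsmul]

end Filtration

/-- Let `A` be a finitely generated abelian group with an endomorphism `φ` and `q` a prime.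
Suppose `A` has a finite filtration `⊥ = F 0 ⊆ F 1 ⊆ ⋯ ⊆ F m = A` by `φ`-invariant subgroups
such that on each quotient `F (i+1) / F i`, `φ` acts modulo `q` by a scalar `lam i` which is
invertible mod `q` (i.e. `φ x - lam i • x ∈ F i + q·F (i+1)` for `x ∈ F (i+1)`), with
`lam 0, …, lam (m-1)` pairwise distinct mod `q`.  Then the `q`-primary torsion of `A` is
isomorphic to the direct sum of the `q`-primary torsions of the quotients `F (i+1) / F i`. -/
theorem qtorsion_splits_along_filtration (q : ℕ) (hq : q.Prime) (m : ℕ)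
    (A : Type) [AddCommGroup A] (hfg : AddGroup.FG A)
    (φ : A →+ A)
    (F : Fin (m + 1) → AddSubgroup A)
    (hmono : Monotone F) (hbot : F 0 = ⊥) (htop : F (Fin.last m) = ⊤)
    (hinv : ∀ i : Fin (m + 1), ∀ x ∈ F i, φ x ∈ F i)
    (lam : Fin m → ℤ)
    (hunit : ∀ i, ¬ ((q : ℤ) ∣ lam i))
    (hdist : ∀ i j, i ≠ j → ¬ ((q : ℤ) ∣ (lam i - lam j)))
    (heig : ∀ i : Fin m, ∀ x ∈ F i.succ, ∃ y ∈ F i.castSucc, ∃ z ∈ F i.succ,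
      φ x - lam i • x = y + (q : ℤ) • z) :
    Nonempty ((qPrimaryTorsion q A) ≃+
      ⨁ i : Fin m,
        (qPrimaryTorsion q (F i.succ ⧸ (F i.castSucc).addSubgroupOf (F i.succ)))) := by
  have hφ : ∀ i, ∀ x ∈ F i, φ.toIntLinearMap x ∈ F i := hinv
  have heig' : ∀ i : Fin m, ∀ x ∈ F i.succ, ∃ y ∈ F i.castSucc, ∃ z ∈ F i.succ,
      φ.toIntLinearMap x - lam i • x = y + q • z := by
    simpa only [natCast_zsmul, AddMonoidHom.coe_toIntLinearMap] using heig
  have hstep : ∀ i : Fin m, Nonempty (qPrimaryTorsion q (F i.succ) ≃+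
      qPrimaryTorsion q (F i.castSucc) ×
        qPrimaryTorsion q (F i.succ ⧸ (F i.castSucc).addSubgroupOf (F i.succ))) := by
    intro i
    have hle : F i.castSucc ≤ F i.succ := hmono i.castSucc_le_succ
    have hfgi : AddGroup.FG (F i.succ) := by
      have : Module.Finite ℤ A := Module.Finite.iff_addGroup_fg.mpr hfg
      exact Module.Finite.iff_addGroup_fg.mp
        (inferInstanceAs (Module.Finite ℤ (AddSubgroup.toIntSubmodule (F i.succ))))
    set P : ℤ[X] := ∏ j : Fin m with j.castSucc < i.castSucc, (X - C (lam j)) with hP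
    have hu : IsCoprime (P.eval (lam i)) (q : ℤ) := by
      rw [hP, eval_prod]
      refine IsCoprime.prod_left fun j hj => ?_
      have hne : i ≠ j := by
        rintro rfl
        simp at hj
      rw [eval_sub, eval_X, eval_C]
      exact ((Nat.prime_iff_prime_int.mp hq).coprime_iff_not_dvd.mpr (hdist i j hne)).symm
    have hB := exists_aeval_prod_eq_smul hmono hbot hφ heig' i.castSucc
    have hC := exists_aeval_sub_eval_smul (hφ _) (hφ _) (heig' i) P
    let Ψ : Module.End ℤ (F i.succ) :=
      (AddMonoidHom.codRestrict ((aeval φ.toIntLinearMap P).toAddMonoidHom.comp (F i.succ).subtype)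
        (F i.succ) fun x => aeval_apply_mem_of_forall _ _ P (hφ _) x.2).toIntLinearMap
    obtain ⟨e⟩ := nonempty_qPrimaryTorsion_addEquiv_prod_of_isCoprime
      ((F i.castSucc).addSubgroupOf (F i.succ)) hfgi Ψ hu
      (fun b hb => by
        obtain ⟨b', hb', h⟩ := hB b hb
        exact ⟨⟨b', hle hb'⟩, hb', Subtype.ext h⟩)
      (fun a => by
        obtain ⟨y, hy, z, hz, h⟩ := hC a a.2
        exact ⟨⟨y, hle hy⟩, hy, ⟨z, hz⟩, Subtype.ext h⟩)
    exact ⟨e.trans ((qPrimaryTorsionCongr q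
      (AddSubgroup.addSubgroupOfEquivOfLe hle)).prodCongr (AddEquiv.refl _))⟩
  have h0 : Subsingleton (F 0) := by
    rw [hbot]
    infer_instance
  obtain ⟨e⟩ := nonempty_addEquiv_pi_of_forall_addEquiv_prod
    (fun i => qPrimaryTorsion q (F i)) _ inferInstance hstep
  have hlast : F (Fin.last m) ≃+ A := (AddEquiv.addSubgroupCongr htop).trans AddSubgroup.topEquiv
  exact ⟨(qPrimaryTorsionCongr q hlast.symm).trans (e.trans (DirectSum.addEquivProd _).symm)⟩
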